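/- arXiv:1008.2680 — 2 statements merged into one kernel-verified Lean document; each statement's English description precedes it below -/
import Mathlib

section
/- For every n ≥ 1 and all integers c_1, …, c_n with |c_i| ≥ 2 for every i, the negative continued fraction [c_1, …, c_n] is well defined (i.e. at every stage of the recursion the denominator c_k − [c_{k+1}, …, c_n] is nonzero), and moreover 0 < [c_1, …, c_n] < 1 if c_1 ≥ 2, while −1 < [c_1, …, c_n] < 0 if c_1 ≤ −2. -/
/-- The negative continued fraction `[c₁, …, cₙ] = 1/(c₁ − 1/(c₂ − ⋯ − 1/cₙ))`,
defined recursively by `ncf [] = 0` and `ncf (c :: cs) = 1/(c − ncf cs)`. -/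
def ncf : List ℤ → ℚ
  | [] => 0
  | c :: cs => 1 / ((c : ℚ) - ncf cs)

theorem one_div_sub_mem_Ioo_zero_one {c : ℤ} {x : ℚ} (hc : 2 ≤ c) (hx : |x| < 1) :
    0 < 1 / ((c : ℚ) - x) ∧ 1 / ((c : ℚ) - x) < 1 := by
  have hc' : (2 : ℚ) ≤ c := by exact_mod_cast hc
  have hden : 1 < (c : ℚ) - x := by linarith [(abs_lt.mp hx).2]
  have hpos : 0 < (c : ℚ) - x := by linarith
  exact ⟨one_div_pos.mpr hpos, (div_lt_one hpos).mpr hden⟩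

theorem one_div_sub_mem_Ioo_neg_one_zero {c : ℤ} {x : ℚ} (hc : c ≤ -2) (hx : |x| < 1) :
    -1 < 1 / ((c : ℚ) - x) ∧ 1 / ((c : ℚ) - x) < 0 := by
  have h := one_div_sub_mem_Ioo_zero_one (c := -c) (x := -x) (by omega) (by rwa [abs_neg])
  have heq : 1 / (((-c : ℤ) : ℚ) - -x) = -(1 / ((c : ℚ) - x)) := by
    rw [← one_div_neg_eq_neg_one_div]
    push_cast
    ring
  rw [heq] at h
  constructor <;> linarith [h.1, h.2]

theorem abs_ncf_lt_one {cs : List ℤ} (h : ∀ x ∈ cs, 2 ≤ |x|) : |ncf cs| < 1 := by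
  induction cs with
  | nil => simp [ncf]
  | cons c cs ih =>
    obtain ⟨hc, hcs⟩ := List.forall_mem_cons.mp h
    rw [ncf, abs_lt]
    rcases le_abs.mp hc with hc | hc
    · have := one_div_sub_mem_Ioo_zero_one hc (ih hcs)
      constructor <;> linarith [this.1, this.2]
    · have := one_div_sub_mem_Ioo_neg_one_zero (c := c) (by omega) (ih hcs)
      constructor <;> linarith [this.1, this.2]

/-- For integers `c₁, …, cₙ` (`n ≥ 1`) with `|cᵢ| ≥ 2`, the negative continued fraction
is well defined (every denominator appearing in the recursion is nonzero), and
`0 < [c₁, …, cₙ] < 1` if `c₁ ≥ 2`, while `−1 < [c₁, …, cₙ] < 0` if `c₁ ≤ −2`. -/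
theorem ncf_wellDefined_and_bounds (c : ℤ) (cs : List ℤ)
    (h : ∀ x ∈ c :: cs, 2 ≤ |x|) :
    (∀ (d : ℤ) (ds : List ℤ), (d :: ds) <:+ (c :: cs) → (d : ℚ) - ncf ds ≠ 0) ∧
    (2 ≤ c → 0 < ncf (c :: cs) ∧ ncf (c :: cs) < 1) ∧
    (c ≤ -2 → -1 < ncf (c :: cs) ∧ ncf (c :: cs) < 0) := by
  have hcs : |ncf cs| < 1 := abs_ncf_lt_one (List.forall_mem_cons.mp h).2
  refine ⟨fun d ds hsuf hzero => ?_, fun hc => one_div_sub_mem_Ioo_zero_one hc hcs,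
    fun hc => one_div_sub_mem_Ioo_neg_one_zero hc hcs⟩
  obtain ⟨hd, hds⟩ := List.forall_mem_cons.mp fun x hx => h x (hsuf.subset hx)
  have hlt := abs_ncf_lt_one hds
  rw [← sub_eq_zero.mp hzero] at hlt
  have : |d| < 1 := by exact_mod_cast hlt
  omega
end

section
/- Let v be an integer and let c_1, …, c_n be integers with |c_i| ≥ 2 for all i. Set r_{−1} = ∞ (represented as 1/0), r_0 = v, and r_j = v + [c_1, …, c_j] for 1 ≤ j ≤ n. Then for every 0 ≤ j ≤ n − 1 one has Δ(r_{j−1}, r_{j+1}) = |c_{j+1}|; that is, the distance Δ between the two vertices adjacent to the j-th interior vertex of the corresponding path in the Hatcher–Thurston diagram equals the absolute value of the corresponding partial quotient. -/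
/-- The numerator and denominator of a negative continued fraction, obtained by clearing
denominators in the recursion; the denominator may be negative. -/
def ncfPair : List ℤ → ℤ × ℤ
  | [] => (0, 1)
  | c :: cs => ((ncfPair cs).2, c * (ncfPair cs).2 - (ncfPair cs).1)

theorem ncfPair_isCoprime (l : List ℤ) : IsCoprime (ncfPair l).1 (ncfPair l).2 := by
  induction l with
  | nil => exact isCoprime_one_right
  | cons c cs ih =>
    obtain ⟨a, b, h⟩ := ih
    exact ⟨b + a * c, -a, by simp only [ncfPair]; linear_combination h⟩

theorem abs_ncfPair_fst_lt_snd (l : List ℤ) (hl : ∀ c ∈ l, 2 ≤ |c|) :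
    |(ncfPair l).1| < |(ncfPair l).2| := by
  induction l with
  | nil => simp [ncfPair]
  | cons c cs ih =>
    have hcs := ih fun x hx => hl x (List.mem_cons_of_mem c hx)
    have hc : 2 ≤ |c| := hl c List.mem_cons_self
    have htri := abs_sub_abs_le_abs_sub (c * (ncfPair cs).2) (ncfPair cs).1
    rw [abs_mul] at htri
    simp only [ncfPair]
    nlinarith [abs_nonneg (ncfPair cs).2]

theorem ncfPair_snd_ne_zero (l : List ℤ) (hl : ∀ c ∈ l, 2 ≤ |c|) : (ncfPair l).2 ≠ 0 :=
  abs_pos.mp ((abs_nonneg _).trans_lt (abs_ncfPair_fst_lt_snd l hl))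

theorem ncf_eq_div (l : List ℤ) (hl : ∀ c ∈ l, 2 ≤ |c|) :
    ncf l = ((ncfPair l).1 : ℚ) / (ncfPair l).2 := by
  induction l with
  | nil => simp [ncf, ncfPair]
  | cons c cs ih =>
    have htail : ∀ x ∈ cs, 2 ≤ |x| := fun x hx => hl x (List.mem_cons_of_mem c hx)
    have hne : ((ncfPair cs).2 : ℚ) ≠ 0 := mod_cast ncfPair_snd_ne_zero cs htail
    rw [ncf, ih htail, ncfPair, sub_div' hne, one_div_div]
    push_cast
    rfl

theorem ncfPair_det_append (l : List ℤ) (a b : ℤ) :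
    (ncfPair l).1 * (ncfPair (l ++ [a, b])).2 - (ncfPair (l ++ [a, b])).1 * (ncfPair l).2 = -b := by
  induction l with
  | nil => simp [ncfPair]
  | cons c cs ih =>
    simp only [List.cons_append, ncfPair]
    linear_combination ih

theorem Rat.exists_unit_num_den_of_isCoprime {p q : ℤ} (hq : q ≠ 0) (h : IsCoprime p q) :
    ∃ e : ℤ, |e| = 1 ∧ ((p : ℚ) / q).num = e * p ∧ (((p : ℚ) / q).den : ℤ) = e * q := by
  rcases hq.lt_or_gt with hneg | hpos
  · have hpos : 0 < -q := neg_pos.mpr hneg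
    have hcop : (-p).natAbs.Coprime (-q).natAbs := Int.isCoprime_iff_nat_coprime.mp h.neg_neg
    have heq : (p : ℚ) / q = ((-p : ℤ) : ℚ) / ((-q : ℤ) : ℚ) := by
      push_cast
      exact (neg_div_neg_eq _ _).symm
    refine ⟨-1, by simp, ?_, ?_⟩
    · rw [heq, Rat.num_div_eq_of_coprime hpos hcop, neg_one_mul]
    · rw [heq, Rat.den_div_eq_of_coprime hpos hcop, neg_one_mul]
  · have hcop := Int.isCoprime_iff_nat_coprime.mp h
    exact ⟨1, by simp, by rw [Rat.num_div_eq_of_coprime hpos hcop, one_mul],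
      by rw [Rat.den_div_eq_of_coprime hpos hcop, one_mul]⟩

theorem exists_unit_num_den_add_ncf (v : ℤ) (l : List ℤ) (hl : ∀ c ∈ l, 2 ≤ |c|) :
    ∃ e : ℤ, |e| = 1 ∧ ((v : ℚ) + ncf l).num = e * ((ncfPair l).1 + v * (ncfPair l).2) ∧
      (((v : ℚ) + ncf l).den : ℤ) = e * (ncfPair l).2 := by
  have hne := ncfPair_snd_ne_zero l hl
  have hneQ : ((ncfPair l).2 : ℚ) ≠ 0 := mod_cast hne
  have heq : (v : ℚ) + ncf l =
      (((ncfPair l).1 + v * (ncfPair l).2 : ℤ) : ℚ) / (ncfPair l).2 := by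
    rw [ncf_eq_div l hl]
    push_cast
    field_simp
    ring
  rw [heq]
  exact Rat.exists_unit_num_den_of_isCoprime hne
    ((ncfPair_isCoprime l).add_mul_right_left v)

/-- Let `v ∈ ℤ` and `c₁, …, cₙ ∈ ℤ` with `|cᵢ| ≥ 2`.  With `r₋₁ = ∞ = 1/0`, `r₀ = v`,
and `r_j = v + [c₁, …, c_j]` (in lowest terms `p_j/q_j`, `q_j > 0`), for every
`0 ≤ j ≤ n − 1` one has `Δ(r_{j−1}, r_{j+1}) = |c_{j+1}|`.  (Here `c i` denotes
`c_{i+1}`; the case `j = 0` reads `Δ(1/0, r₁) = q₁ = |c₁|`, and the case `j ≥ 1` is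
stated for `r j` and `r (j+2)` with corner entry `c (j+1)`.) -/
theorem ncf_path_corner_delta (v : ℤ) (n : ℕ) (c : ℕ → ℤ)
    (hc : ∀ i < n, 2 ≤ |c i|) :
    let r : ℕ → ℚ := fun j => (v : ℚ) + ncf (List.ofFn fun i : Fin j => c i)
    (1 ≤ n → ((r 1).den : ℤ) = |c 0|) ∧
    ∀ j, j + 2 ≤ n →
      |(r j).num * ((r (j + 2)).den : ℤ) - (r (j + 2)).num * ((r j).den : ℤ)| = |c (j + 1)| := by
  intro r
  have hmem : ∀ j ≤ n, ∀ x ∈ List.ofFn (fun i : Fin j => c i), 2 ≤ |x| := by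
    intro j hj x hx
    obtain ⟨i, rfl⟩ := List.mem_ofFn.mp hx
    exact hc i (i.isLt.trans_le hj)
  refine ⟨fun hn => ?_, fun j hj => ?_⟩
  · obtain ⟨e, he, -, hden⟩ := exists_unit_num_den_add_ncf v _ (hmem 1 hn)
    rw [← abs_of_nonneg (Int.natCast_nonneg (r 1).den), hden, abs_mul, he]
    simp [ncfPair]
  · have happ : List.ofFn (fun i : Fin (j + 2) => c i) =
        List.ofFn (fun i : Fin j => c i) ++ [c j, c (j + 1)] := by
      rw [List.ofFn_succ_last, List.ofFn_succ_last, List.append_assoc]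
      rfl
    obtain ⟨e, he, hnum, hden⟩ := exists_unit_num_den_add_ncf v _ (hmem j (by omega))
    obtain ⟨e', he', hnum', hden'⟩ := exists_unit_num_den_add_ncf v _ (hmem (j + 2) hj)
    have hdet := ncfPair_det_append (List.ofFn fun i : Fin j => c i) (c j) (c (j + 1))
    rw [← happ] at hdet
    have key : (r j).num * ((r (j + 2)).den : ℤ) - (r (j + 2)).num * ((r j).den : ℤ) =
        e * e' * -c (j + 1) := by
      rw [hnum, hden, hnum', hden', ← hdet]
      ring
    rw [key, abs_mul, abs_mul, he, he', abs_neg, one_mul, one_mul]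
end
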